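/- Let g = ⊕_j g_j be a good grading for a nonzero nilpotent e in a finite-dimensional semisimple Lie algebra over an algebraically closed field of characteristic zero. Define ω on g_{-1} by ω(x,y) = κ(e, [x,y]), where κ is the Killing form. Then ω is an alternating nondegenerate bilinear form on g_{-1}. -/

import Mathlib

/-- In a graded Lie algebra, pieces of degrees `i` and `j` with `i + j ≠ 0` are orthogonal with
respect to the Killing form. -/
theorem killingForm_eq_zero_of_add_ne_zero {K L : Type*} [Field K]
    [LieRing L] [LieAlgebra K L] [Module.Finite K L]
    (G : ℤ → Submodule K L) (hdecomp : DirectSum.IsInternal G)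
    (hbr : ∀ i j : ℤ, ∀ x ∈ G i, ∀ y ∈ G j, ⁅x, y⁆ ∈ G (i + j))
    {i j : ℤ} (hij : i + j ≠ 0) {x y : L} (hx : x ∈ G i) (hy : y ∈ G j) :
    killingForm K L x y = 0 := by
  rw [killingForm_apply_apply]
  refine LinearMap.trace_eq_zero_of_mapsTo_ne hdecomp (fun k ↦ i + (j + k))
    (fun k ↦ by omega) fun k z hz ↦ ?_
  exact hbr _ _ _ hx _ (hbr _ _ _ hy _ hz)

/-- For a good grading of a nonzero nilpotent `e` in a finite-dimensional semisimple Lie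
algebra over an algebraically closed field of characteristic zero, the form
`ω(x,y) = κ(e, [x,y])` is an alternating nondegenerate bilinear form on `g (-1)`. -/
theorem stmt_10 {K L : Type*} [Field K] [IsAlgClosed K] [CharZero K]
    [LieRing L] [LieAlgebra K L] [Module.Finite K L] [LieAlgebra.IsSemisimple K L]
    (G : ℤ → Submodule K L) (hdecomp : DirectSum.IsInternal G)
    (hbr : ∀ i j : ℤ, ∀ x ∈ G i, ∀ y ∈ G j, ⁅x, y⁆ ∈ G (i + j))
    (e : L) (hne : e ≠ 0) (he : e ∈ G 2)
    (hinj : ∀ j : ℤ, j ≤ -1 → ∀ x ∈ G j, ⁅e, x⁆ = 0 → x = 0)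
    (hsurj : ∀ j : ℤ, -1 ≤ j → ∀ y ∈ G (j + 2), ∃ x ∈ G j, ⁅e, x⁆ = y) :
    (∀ x ∈ G (-1), killingForm K L e ⁅x, x⁆ = 0) ∧
    (∀ x ∈ G (-1), (∀ y ∈ G (-1), killingForm K L e ⁅x, y⁆ = 0) → x = 0) := by
  refine ⟨fun x _ ↦ by simp, fun x hx hker ↦ hinj (-1) le_rfl x hx ?_⟩
  refine (LieAlgebra.IsKilling.killingForm_nondegenerate K L).1 _ fun y ↦ ?_
  have hy : y ∈ ⨆ i, G i := hdecomp.submodule_iSup_eq_top ▸ Submodule.mem_top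
  induction hy using Submodule.iSup_induction' with
  | mem i y hy =>
    by_cases hi : i = -1
    · subst hi
      rw [LieModule.traceForm_apply_lie_apply]
      exact hker y hy
    · exact killingForm_eq_zero_of_add_ne_zero G hdecomp hbr (by omega) (hbr _ _ _ he _ hx) hy
  | zero => simp
  | add y z _ _ hy hz => rw [map_add, hy, hz, add_zero]
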